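/- arXiv:2011.00142 — 10 statements merged into one kernel-verified Lean document; each statement's English description precedes it below -/
import Mathlib

section
/- Let z ∈ F with ‖z‖ < 1. Then the family (z^{q^i})_{i≥0} is summable in F, and its sum b = ∑_{i=0}^∞ z^{q^i} satisfies b − b^q = z and ‖b‖ = ‖z‖. (In particular, the Artin–Schreier equation b − b^q = z has a solution in the open unit ball, given by an explicit convergent series; this is the value 𝔏i₀(z) of the paper.) -/
/-- In a nonarchimedean normed field, if `b` lies in the open unit ball and `1 < q`, then
`b - b ^ q` has the same norm as `b`. -/
theorem norm_sub_pow_eq_of_norm_lt_one {F : Type*} [NormedField F] [IsUltrametricDist F]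
    {q : ℕ} (hq : 1 < q) {b : F} (hb : ‖b‖ < 1) : ‖b - b ^ q‖ = ‖b‖ := by
  rcases eq_or_ne b 0 with rfl | hb0
  · simp [(zero_lt_one.trans hq).ne']
  · have hlt : ‖b ^ q‖ < ‖b‖ := by
      rw [norm_pow]
      exact pow_lt_self_of_lt_one₀ (norm_pos_iff.mpr hb0) hb hq
    rw [sub_eq_add_neg, IsUltrametricDist.norm_add_eq_max_of_norm_ne_norm (by
      rw [norm_neg]; exact hlt.ne'), norm_neg, max_eq_left hlt.le]

/-- For `z` in the open unit ball of a complete normed field and `1 < q`, the family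
`(z^{q^i})` is summable. -/
theorem summable_pow_pow_of_norm_lt_one {F : Type*} [NormedField F] [CompleteSpace F]
    {q : ℕ} (hq : 1 < q) {z : F} (hz : ‖z‖ < 1) : Summable (fun i : ℕ => z ^ q ^ i) := by
  refine Summable.of_norm_bounded (summable_geometric_of_lt_one (norm_nonneg z) hz) fun i => ?_
  rw [norm_pow]
  exact pow_le_pow_of_le_one (norm_nonneg z) hz.le (Nat.lt_pow_self hq).le

/-- For `z` in the open unit ball of a complete nonarchimedean field `F`
of characteristic `p` (with `q = p^s`), the family `(z^{q^i})` is summable, and its sum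
`b` satisfies the Artin–Schreier equation `b - b^q = z` as well as `‖b‖ = ‖z‖`. -/
theorem stmt_0 {p s q : ℕ} (hp : p.Prime) (hs : 0 < s) (hq : q = p ^ s)
    {F : Type*} [NormedField F] [CompleteSpace F] [IsUltrametricDist F] [CharP F p]
    (z : F) (hz : ‖z‖ < 1) :
    Summable (fun i : ℕ => z ^ q ^ i) ∧
    (∑' i : ℕ, z ^ q ^ i) - (∑' i : ℕ, z ^ q ^ i) ^ q = z ∧
    ‖∑' i : ℕ, z ^ q ^ i‖ = ‖z‖ := by
  have : Fact p.Prime := ⟨hp⟩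
  have hq1 : 1 < q := hq ▸ Nat.one_lt_pow hs.ne' hp.one_lt
  have hsum := summable_pow_pow_of_norm_lt_one hq1 hz
  have hpow : (∑' i : ℕ, z ^ q ^ i) ^ q = ∑' i : ℕ, z ^ q ^ (i + 1) := by
    have hfrob : ∀ x : F, iterateFrobenius F p s x = x ^ q := fun x => by
      rw [iterateFrobenius_def, hq]
    have hcont : Continuous (iterateFrobenius F p s) :=
      (continuous_pow q).congr fun x => (hfrob x).symm
    rw [← hfrob, hsum.map_tsum _ hcont]
    simp only [hfrob, ← pow_mul, ← pow_succ]
  have heq : (∑' i : ℕ, z ^ q ^ i) - (∑' i : ℕ, z ^ q ^ i) ^ q = z := by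
    rw [hpow, hsum.tsum_eq_zero_add, pow_zero, pow_one, add_sub_cancel_right]
  have hle : ‖∑' i : ℕ, z ^ q ^ i‖ ≤ ‖z‖ :=
    IsUltrametricDist.norm_tsum_le_of_forall_le_of_nonneg (norm_nonneg z) fun i => by
      rw [norm_pow]
      exact pow_le_of_le_one (norm_nonneg z) hz.le (pow_pos (zero_lt_one.trans hq1) i).ne'
  refine ⟨hsum, heq, ?_⟩
  rw [← norm_sub_pow_eq_of_norm_lt_one hq1 (hle.trans_lt hz), heq]
end

section
/- Let a : ℕ → F be a sequence with ‖a_i‖ → 0 as i → ∞. Then there exists a sequence b : ℕ → F with ‖b_i‖ → 0 and b_i − b_i^q = a_i for all i. Moreover, for any two sequences b, b' with these properties, the set {i : b_i ≠ b'_i} is finite, and for every i the difference c_i = b_i − b'_i satisfies c_i^q = c_i. (This is the surjectivity of the map ℘(f) = f − f^{(1)} on the Tate algebra 𝕋, with inverse image well defined modulo 𝔽_q[t]: Lemma 1.1(1) in coefficient form.) -/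
/-- In a complete ultrametric field of characteristic `p`, the equation `b - b ^ p ^ s = a` with
`‖a‖ < 1` has the solution `b = ∑ k, a ^ (p ^ s) ^ k`, of norm at most `‖a‖`. -/
theorem exists_sub_pow_eq_of_norm_lt_one {p s : ℕ} (hp : p.Prime) (hs : 0 < s)
    {F : Type*} [NormedField F] [CompleteSpace F] [IsUltrametricDist F] [CharP F p]
    {a : F} (ha : ‖a‖ < 1) : ∃ b : F, b - b ^ p ^ s = a ∧ ‖b‖ ≤ ‖a‖ := by
  have : Fact p.Prime := ⟨hp⟩
  have : ExpChar F p := ExpChar.prime hp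
  have hq : 1 < p ^ s := Nat.one_lt_pow hs.ne' hp.one_lt
  have hsum : Summable fun k : ℕ => a ^ (p ^ s) ^ k := by
    refine Summable.of_norm_bounded (summable_geometric_of_lt_one (norm_nonneg a) ha) fun k => ?_
    rw [norm_pow]
    exact pow_le_pow_of_le_one (norm_nonneg a) ha.le (Nat.lt_pow_self hq).le
  refine ⟨∑' k : ℕ, a ^ (p ^ s) ^ k, ?_, ?_⟩
  · have h := hsum.hasSum.map (iterateFrobenius F p s) (by
      exact continuous_pow (M := F) (p ^ s))
    have h' : ∑' k : ℕ, a ^ (p ^ s) ^ (k + 1) = (∑' k : ℕ, a ^ (p ^ s) ^ k) ^ p ^ s := by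
      rw [← iterateFrobenius_def, ← h.tsum_eq]
      exact tsum_congr fun k => by
        rw [Function.comp_apply, iterateFrobenius_def, ← pow_mul a, ← pow_succ]
    rw [← h', hsum.tsum_eq_zero_add]
    simp
  · refine IsUltrametricDist.norm_tsum_le_of_forall_le_of_nonneg (norm_nonneg a) fun k => ?_
    rw [norm_pow]
    exact pow_le_of_le_one (norm_nonneg a) ha.le (pow_pos (by omega) k).ne'

theorem exists_sub_pow_eq {F : Type*} [Field F] [IsAlgClosed F] {q : ℕ} (hq : 1 < q) (a : F) :
    ∃ b : F, b - b ^ q = a := by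
  obtain ⟨b, hb⟩ := IsAlgClosed.exists_root (Polynomial.X ^ q - (Polynomial.X - Polynomial.C a)) (by
    rw [Polynomial.degree_sub_eq_left_of_degree_lt]
    · simp; omega
    · simpa using hq)
  refine ⟨b, ?_⟩
  simp only [Polynomial.IsRoot.def, Polynomial.eval_sub, Polynomial.eval_pow, Polynomial.eval_X,
    Polynomial.eval_C] at hb
  linear_combination -hb

theorem eq_zero_of_pow_eq_self_of_norm_lt_one {F : Type*} [NormedField F] {q : ℕ} (hq : 1 < q)
    {c : F} (hc : c ^ q = c) (h : ‖c‖ < 1) : c = 0 := by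
  by_contra h0
  have h1 := pow_lt_self_of_lt_one₀ (norm_pos_iff.mpr h0) h hq
  rw [← norm_pow, hc] at h1
  exact lt_irrefl _ h1


/-- Coefficientwise surjectivity of `℘(f) = f - f^{(1)}` on the Tate algebra:
given a null sequence `a`, there is a null sequence `b` with `b_i - b_i^q = a_i`; and any two
such sequences differ at only finitely many indices, each difference satisfying `c^q = c`. -/
theorem stmt_3 {p s q : ℕ} (hp : p.Prime) (hs : 0 < s) (hq : q = p ^ s)
    {F : Type*} [NormedField F] [CompleteSpace F] [IsUltrametricDist F] [CharP F p]
    [IsAlgClosed F]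
    (a : ℕ → F) (ha : Filter.Tendsto (fun i => ‖a i‖) Filter.atTop (nhds 0)) :
    (∃ b : ℕ → F, Filter.Tendsto (fun i => ‖b i‖) Filter.atTop (nhds 0) ∧
      ∀ i, b i - (b i) ^ q = a i) ∧
    (∀ b b' : ℕ → F,
      Filter.Tendsto (fun i => ‖b i‖) Filter.atTop (nhds 0) →
      (∀ i, b i - (b i) ^ q = a i) →
      Filter.Tendsto (fun i => ‖b' i‖) Filter.atTop (nhds 0) →
      (∀ i, b' i - (b' i) ^ q = a i) →
      {i : ℕ | b i ≠ b' i}.Finite ∧ ∀ i, (b i - b' i) ^ q = b i - b' i) := by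
  subst hq
  have : Fact p.Prime := ⟨hp⟩
  have hq : 1 < p ^ s := Nat.one_lt_pow hs.ne' hp.one_lt
  refine ⟨?_, fun b b' hb hba hb' hba' => ?_⟩
  · have key (i : ℕ) : ∃ b : F, b - b ^ p ^ s = a i ∧ (‖a i‖ < 1 → ‖b‖ ≤ ‖a i‖) := by
      by_cases h : ‖a i‖ < 1
      · obtain ⟨b, hb, hn⟩ := exists_sub_pow_eq_of_norm_lt_one hp hs h
        exact ⟨b, hb, fun _ => hn⟩
      · obtain ⟨b, hb⟩ := exists_sub_pow_eq hq (a i)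
        exact ⟨b, hb, fun h' => absurd h' h⟩
    choose b hb hn using key
    refine ⟨b, squeeze_zero' (.of_forall fun i => norm_nonneg _) ?_ ha, hb⟩
    filter_upwards [ha.eventually_lt_const one_pos] with i hi using hn i hi
  · have hc (i : ℕ) : (b i - b' i) ^ p ^ s = b i - b' i := by
      rw [sub_pow_char_pow]
      linear_combination hba' i - hba i
    refine ⟨?_, hc⟩
    have hev : ∀ᶠ i in Filter.atTop, b i = b' i := by
      filter_upwards [hb.eventually_lt_const one_pos, hb'.eventually_lt_const one_pos]
        with i hi hi'
      refine sub_eq_zero.mp (eq_zero_of_pow_eq_self_of_norm_lt_one hq (hc i) ?_)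
      rw [sub_eq_add_neg]
      exact (IsUltrametricDist.norm_add_le_max _ _).trans_lt (max_lt hi (by rwa [norm_neg]))
    rwa [← Nat.cofinite_eq_atTop, Filter.eventually_cofinite] at hev
end

section
/- Let a, b : ℕ → F be sequences with ‖a_i‖ → 0 and ‖b_i‖ → 0 such that b_i − b_i^q = a_i for all i. Then ‖b_i‖ = ‖a_i‖ for all sufficiently large i, and consequently, for every real number r > 0, one has ‖a_i‖·r^i → 0 as i → ∞ if and only if ‖b_i‖·r^i → 0 as i → ∞. (Thus f ∈ 𝕋 and ℘(f) = f − f^{(1)} have the same radius of convergence: Lemma 1.1(2).) -/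
/-- In an ultrametric normed field, `x - x ^ n` has the same norm as `x` whenever `‖x‖ < 1`
and `2 ≤ n`. -/
theorem norm_sub_pow_eq_norm {F : Type*} [NormedField F] [IsUltrametricDist F] {x : F} {n : ℕ}
    (hn : 2 ≤ n) (hx : ‖x‖ < 1) : ‖x - x ^ n‖ = ‖x‖ := by
  rcases eq_or_ne x 0 with rfl | h0
  · simp [show n ≠ 0 by omega]
  · have hlt : ‖x ^ n‖ < ‖x‖ := by
      rw [norm_pow]
      exact pow_lt_self_of_lt_one₀ (norm_pos_iff.mpr h0) hx hn
    rw [sub_eq_add_neg, IsUltrametricDist.norm_add_eq_max_of_norm_ne_norm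
      (by rw [norm_neg]; exact hlt.ne'), norm_neg, max_eq_left hlt.le]

/-- If null sequences `a`, `b` satisfy `b_i - b_i^q = a_i` for all `i`,
then `‖b_i‖ = ‖a_i‖` for all sufficiently large `i`, and for every `r > 0` the sequence
`‖a_i‖·r^i` tends to `0` iff `‖b_i‖·r^i` does (same radius of convergence for `f` and `℘(f)`). -/
theorem stmt_4 {p s q : ℕ} (hp : p.Prime) (hs : 0 < s) (hq : q = p ^ s)
    {F : Type*} [NormedField F] [CompleteSpace F] [IsUltrametricDist F] [CharP F p]
    (a b : ℕ → F)
    (ha : Filter.Tendsto (fun i => ‖a i‖) Filter.atTop (nhds 0))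
    (hb : Filter.Tendsto (fun i => ‖b i‖) Filter.atTop (nhds 0))
    (hab : ∀ i, b i - (b i) ^ q = a i) :
    (∀ᶠ i in Filter.atTop, ‖b i‖ = ‖a i‖) ∧
    (∀ r : ℝ, 0 < r →
      (Filter.Tendsto (fun i => ‖a i‖ * r ^ i) Filter.atTop (nhds 0) ↔
        Filter.Tendsto (fun i => ‖b i‖ * r ^ i) Filter.atTop (nhds 0))) := by
  have hq2 : 2 ≤ q := hq ▸ hp.two_le.trans (Nat.le_self_pow hs.ne' p)
  have h : ∀ᶠ i in Filter.atTop, ‖b i‖ = ‖a i‖ := by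
    filter_upwards [hb.eventually_lt_const one_pos] with i hi
    rw [← hab i, norm_sub_pow_eq_norm hq2 hi]
  refine ⟨h, fun r _ => Filter.tendsto_congr' ?_⟩
  filter_upwards [h] with i hi
  rw [hi]
end

section
/- Let θ ∈ F and let g, h : ℕ → F be coefficient sequences such that for every y ∈ F the families (g_i·y^i)_i and (h_i·y^i)_i are summable; write G(y) = ∑_i g_i·y^i and H(y) = ∑_i h_i·y^i. Assume g_i − g_i^q = h_i for all i, and H(θ^{q^k}) = 0 for all integers k ≥ 1. Then G(θ^{q^{k+1}}) = G(θ^{q^k})^q for all k ≥ 0, and hence G(θ^{q^k}) = G(θ)^{q^k} for all k ≥ 0. (This is the evaluation identity underlying Lemma 1.4(3) and Proposition 1.7(4): values of the entire solution of the difference equation at θ^{q^k} are the q^k-th powers of its value at θ.) -/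
/-- The `p ^ s`-power map of a topological ring of characteristic `p` commutes with convergent
sums. -/
theorem HasSum.pow_char_pow {ι R : Type*} [CommSemiring R] [TopologicalSpace R]
    [IsTopologicalSemiring R] (p s : ℕ) [ExpChar R p] {f : ι → R} {a : R} (hf : HasSum f a) :
    HasSum (fun i => f i ^ p ^ s) (a ^ p ^ s) :=
  hf.map (iterateFrobenius R p s) (continuous_pow (p ^ s))


/-- If everywhere-convergent power series `G`, `H` (with coefficients `g`, `h`)
satisfy `g_i - g_i^q = h_i` and `H(θ^{q^k}) = 0` for all `k ≥ 1`, then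
`G(θ^{q^{k+1}}) = G(θ^{q^k})^q` and hence `G(θ^{q^k}) = G(θ)^{q^k}` for all `k ≥ 0`. -/
theorem stmt_8 {p s q : ℕ} (hp : p.Prime) (hs : 0 < s) (hq : q = p ^ s)
    {F : Type*} [NormedField F] [CompleteSpace F] [IsUltrametricDist F] [CharP F p]
    (θ : F) (g h : ℕ → F)
    (hg : ∀ y : F, Summable (fun i : ℕ => g i * y ^ i))
    (hh : ∀ y : F, Summable (fun i : ℕ => h i * y ^ i))
    (hgh : ∀ i, g i - (g i) ^ q = h i)
    (hzero : ∀ k : ℕ, 1 ≤ k → ∑' i : ℕ, h i * (θ ^ q ^ k) ^ i = 0) :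
    (∀ k : ℕ, ∑' i : ℕ, g i * (θ ^ q ^ (k + 1)) ^ i =
      (∑' i : ℕ, g i * (θ ^ q ^ k) ^ i) ^ q) ∧
    (∀ k : ℕ, ∑' i : ℕ, g i * (θ ^ q ^ k) ^ i = (∑' i : ℕ, g i * θ ^ i) ^ q ^ k) := by
  have step : ∀ k : ℕ, ∑' i : ℕ, g i * (θ ^ q ^ (k + 1)) ^ i =
      (∑' i : ℕ, g i * (θ ^ q ^ k) ^ i) ^ q := by
    intro k
    have : ExpChar F p := ExpChar.prime hp
    have hpow := (hg (θ ^ q ^ k)).hasSum.pow_char_pow p s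
    rw [← hq] at hpow
    have hsub := (hg (θ ^ q ^ (k + 1))).hasSum.sub (hh (θ ^ q ^ (k + 1))).hasSum
    rw [hzero (k + 1) (Nat.le_add_left 1 k), sub_zero] at hsub
    refine hsub.unique (hpow.congr_fun ?_)
    intro i
    rw [← hgh i, mul_pow, pow_succ q k, pow_mul θ, pow_right_comm _ q i]
    ring
  refine ⟨step, fun k => ?_⟩
  induction k with
  | zero => simp
  | succ k ih => rw [step, ih, ← pow_mul, ← pow_succ]
end

section
/- Let d ≥ 1 and z_1, …, z_d ∈ F with ‖z_j‖ < 1 for all j. Then the family (z_1^{q^{i_1}}⋯z_d^{q^{i_d}}) indexed by tuples of integers 0 ≤ i_1 < ⋯ < i_d is summable; writing S_d(z_1,…,z_d) for its sum (with the convention S_0 = 1), one has S_d(z_1,…,z_d) − S_d(z_1,…,z_d)^q = z_1 · S_{d−1}(z_2,…,z_d)^q. (This is the system of Artin–Schreier difference equations ℘(𝔏i_{{0}^d}(Z_1,…,Z_d)) = Z_1·𝔏i_{{0}^{d−1}}(Z_2,…,Z_d)^{(1)} for scalar arguments.) -/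
/-- `S_d(z_1,…,z_d) = ∑_{0 ≤ i_1 < ⋯ < i_d} z_1^{q^{i_1}} ⋯ z_d^{q^{i_d}}`
(the value `𝔏i_{{0}^d}(z_1,…,z_d)` of the paper); `S_0 = 1` (empty product over the
unique empty strictly monotone tuple). -/
noncomputable def Scmpl (q : ℕ) {F : Type*} [NormedField F] (d : ℕ) (z : Fin d → F) : F :=
  ∑' f : {f : Fin d → ℕ // StrictMono f}, ∏ j, z j ^ q ^ (f.1 j)

/-- The shift `f ↦ f + 1` on strictly increasing tuples. -/
def strictMonoShift {n : ℕ} (f : {f : Fin n → ℕ // StrictMono f}) :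
    {f : Fin n → ℕ // StrictMono f} :=
  ⟨fun j => f.1 j + 1, fun _ _ h => Nat.succ_lt_succ (f.2 h)⟩

/-- Shifting a strictly increasing tuple and prepending `0`. -/
def strictMonoCons {n : ℕ} (g : {g : Fin n → ℕ // StrictMono g}) :
    {f : Fin (n + 1) → ℕ // StrictMono f} :=
  ⟨Fin.cons 0 (strictMonoShift g).1, by
    intro a b h
    cases b using Fin.cases with
    | zero => exact absurd h (Fin.not_lt_zero a)
    | succ b =>
      cases a using Fin.cases with
      | zero => simp [strictMonoShift]
      | succ a => simpa using (strictMonoShift g).2 (Fin.succ_lt_succ_iff.1 h)⟩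

theorem strictMonoShift_injective {n : ℕ} : Function.Injective (strictMonoShift (n := n)) := by
  intro f g h
  ext j
  simpa [strictMonoShift] using congrFun (congrArg Subtype.val h) j

theorem strictMonoCons_injective {n : ℕ} : Function.Injective (strictMonoCons (n := n)) := by
  intro f g h
  ext j
  simpa [strictMonoCons, strictMonoShift] using congrFun (congrArg Subtype.val h) j.succ

theorem isCompl_range_strictMonoShift_strictMonoCons {n : ℕ} :
    IsCompl (Set.range (strictMonoShift (n := n + 1))) (Set.range (strictMonoCons (n := n))) := by
  constructor
  · rw [Set.disjoint_left]
    rintro _ ⟨f, rfl⟩ ⟨g, h⟩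
    simpa [strictMonoCons, strictMonoShift] using congrFun (congrArg Subtype.val h) 0
  · rw [codisjoint_iff_le_sup]
    intro f _
    rcases Nat.eq_zero_or_pos (f.1 0) with h | h
    · have hpos (j : Fin n) : 0 < f.1 j.succ := h ▸ f.2 j.succ_pos
      refine Or.inr ⟨⟨fun j => f.1 j.succ - 1, fun a b hab => ?_⟩, ?_⟩
      · have := f.2 (Fin.succ_lt_succ_iff.2 hab)
        have := hpos a
        dsimp only
        omega
      · ext j
        cases j using Fin.cases with
        | zero => exact h.symm
        | succ j => exact Nat.sub_add_cancel (hpos j)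
    · have hpos (j : Fin (n + 1)) : 0 < f.1 j := h.trans_le (f.2.monotone j.zero_le)
      refine Or.inl ⟨⟨fun j => f.1 j - 1, fun a b hab => ?_⟩, ?_⟩
      · have := f.2 hab
        have := hpos a
        dsimp only
        omega
      · ext j
        exact Nat.sub_add_cancel (hpos j)

/-- A sum over strictly increasing tuples splits according to whether the first entry is `0`. -/
theorem hasSum_of_shift_of_cons {M : Type*} [AddCommMonoid M] [TopologicalSpace M]
    [ContinuousAdd M] {n : ℕ} {φ : {f : Fin (n + 1) → ℕ // StrictMono f} → M} {a b : M}
    (ha : HasSum (fun f => φ (strictMonoShift f)) a)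
    (hb : HasSum (fun g => φ (strictMonoCons g)) b) : HasSum φ (a + b) :=
  HasSum.add_isCompl isCompl_range_strictMonoShift_strictMonoCons
    (strictMonoShift_injective.hasSum_range_iff.2 ha)
    (strictMonoCons_injective.hasSum_range_iff.2 hb)

theorem summable_prod_pow_pow {q : ℕ} (hq : 1 < q) {F : Type*} [NormedField F] [CompleteSpace F]
    [IsUltrametricDist F] {d : ℕ} (z : Fin d → F) (hz : ∀ j, ‖z j‖ < 1) :
    Summable (fun f : {f : Fin d → ℕ // StrictMono f} => ∏ j, z j ^ q ^ (f.1 j)) := by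
  apply NonarchimedeanAddGroup.summable_of_tendsto_cofinite_zero
  rw [Metric.tendsto_nhds]
  intro ε hε
  have hN (j : Fin d) : ∃ N, ‖z j‖ ^ N < ε := exists_pow_lt_of_lt_one hε (hz j)
  choose N hN using hN
  rw [Filter.eventually_cofinite]
  have hfin : (Set.pi Set.univ fun j => Set.Iio (N j)).Finite :=
    Set.Finite.pi fun j => Set.finite_Iio (N j)
  refine (hfin.preimage Subtype.val_injective.injOn).subset fun f hf j _ => ?_
  simp only [Set.mem_ofPred_eq, dist_zero_right, not_lt, norm_prod, norm_pow] at hf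
  by_contra hj
  refine hf.not_gt (lt_of_le_of_lt ?_ (hN j))
  calc ∏ i, ‖z i‖ ^ q ^ f.1 i ≤ ‖z j‖ ^ q ^ f.1 j := by
        rw [← Finset.mul_prod_erase _ _ (Finset.mem_univ j)]
        exact mul_le_of_le_one_right (by positivity)
          (Finset.prod_le_one (fun _ _ => by positivity)
            fun i _ => pow_le_one₀ (norm_nonneg _) (hz i).le)
    _ ≤ ‖z j‖ ^ N j := by
        refine pow_le_pow_of_le_one (norm_nonneg _) (hz j).le ?_
        exact (not_lt.1 hj).trans (Nat.lt_pow_self hq).le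

/-- The `p ^ s`-power Frobenius acts on the sum by shifting the exponents. -/
theorem hasSum_strictMonoShift {p s : ℕ} (hp : p.Prime) (hs : 0 < s) {F : Type*} [NormedField F]
    [CompleteSpace F] [IsUltrametricDist F] [CharP F p] {d : ℕ} (z : Fin d → F)
    (hz : ∀ j, ‖z j‖ < 1) :
    HasSum (fun f : {f : Fin d → ℕ // StrictMono f} =>
      ∏ j, z j ^ (p ^ s) ^ ((strictMonoShift f).1 j)) (Scmpl (p ^ s) d z ^ p ^ s) := by
  have := Fact.mk hp
  have h := (summable_prod_pow_pow (Nat.one_lt_pow hs.ne' hp.one_lt) z hz).hasSum.map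
    (iterateFrobenius F p s) (continuous_pow (p ^ s))
  rw [iterateFrobenius_def] at h
  change HasSum _ (Scmpl (p ^ s) d z ^ p ^ s) at h
  convert h using 1
  ext f
  simp [strictMonoShift, iterateFrobenius_def, ← pow_mul, pow_succ]

/-- For `‖z_j‖ < 1`, the family `(z_1^{q^{i_1}} ⋯ z_d^{q^{i_d}})` over
strictly increasing tuples `0 ≤ i_1 < ⋯ < i_d` is summable, and the sums satisfy the
Artin–Schreier system `S_d - S_d^q = z_1 · S_{d-1}(z_2,…,z_d)^q`. -/
theorem stmt_9 {p s q : ℕ} (hp : p.Prime) (hs : 0 < s) (hq : q = p ^ s)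
    {F : Type*} [NormedField F] [CompleteSpace F] [IsUltrametricDist F] [CharP F p]
    (d : ℕ) (hd : 1 ≤ d) (z : Fin d → F) (hz : ∀ j, ‖z j‖ < 1) :
    Summable (fun f : {f : Fin d → ℕ // StrictMono f} => ∏ j, z j ^ q ^ (f.1 j)) ∧
    Scmpl q d z - (Scmpl q d z) ^ q =
      z ⟨0, hd⟩ *
        (Scmpl q (d - 1) (fun j => z ⟨j.1 + 1, by have := j.isLt; omega⟩)) ^ q := by
  subst hq
  obtain ⟨n, rfl⟩ : ∃ n, d = n + 1 := ⟨d - 1, by omega⟩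
  have hsum := summable_prod_pow_pow (Nat.one_lt_pow hs.ne' hp.one_lt) z hz
  refine ⟨hsum, ?_⟩
  have hshift := hasSum_strictMonoShift hp hs z hz
  have hcons := (hasSum_strictMonoShift hp hs (fun j : Fin n => z j.succ)
    fun j => hz j.succ).mul_left (z 0)
  have hprod (g : {g : Fin n → ℕ // StrictMono g}) :
      z 0 * ∏ j, z j.succ ^ (p ^ s) ^ ((strictMonoShift g).1 j) =
        ∏ j, z j ^ (p ^ s) ^ ((strictMonoCons g).1 j) := by
    simp [Fin.prod_univ_succ, strictMonoCons]
  simp only [hprod] at hcons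
  have hsplit := hasSum_of_shift_of_cons
    (φ := fun f : {f : Fin (n + 1) → ℕ // StrictMono f} => ∏ j, z j ^ (p ^ s) ^ (f.1 j))
    hshift hcons
  have heq : Scmpl (p ^ s) (n + 1) z = Scmpl (p ^ s) (n + 1) z ^ p ^ s +
      z 0 * Scmpl (p ^ s) n (fun j => z j.succ) ^ p ^ s := hsplit.tsum_eq
  rw [sub_eq_iff_eq_add']
  exact heq
end

section
/- Let d ≥ 1, n_1, …, n_d positive integers, and z_1, …, z_d ∈ F with ‖z_j‖ < ‖θ‖^{n_j·q/(q−1)} for all j. Then each L_i is nonzero with ‖L_i‖ = ‖θ‖^{q(q^i−1)/(q−1)}, and the family (z_1^{q^{i_1}}⋯z_d^{q^{i_d}} / (L_{i_1}^{n_1}⋯L_{i_d}^{n_d})) indexed by tuples of integers 0 ≤ i_1 < ⋯ < i_d is summable in F. (Convergence of the Carlitz multiple polylogarithm Li_{n_1,…,n_d}(z_1,…,z_d) on the polydisk 𝔻′.) -/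
/-- `L_0 = 1`, `L_i = (θ - θ^q)(θ - θ^{q^2}) ⋯ (θ - θ^{q^i})`. -/
noncomputable def Lfac {F : Type*} [NormedField F] (θ : F) (q : ℕ) (i : ℕ) : F :=
  ∏ k ∈ Finset.Icc 1 i, (θ - θ ^ q ^ k)

open Filter Topology

theorem sub_one_mul_sum_Icc_pow {q : ℕ} (hq : 1 < q) (i : ℕ) :
    (q - 1) * ∑ k ∈ Finset.Icc 1 i, q ^ k = q * (q ^ i - 1) := by
  have hpow (k : ℕ) : 1 ≤ q ^ k := Nat.one_le_pow _ _ (by lia)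
  induction i with
  | zero => simp
  | succ i ih =>
    rw [Finset.sum_Icc_succ_top (by lia), mul_add, ih]
    zify [hq.le, hpow i, hpow (i + 1)]
    ring

theorem sum_Icc_pow {q : ℕ} (hq : 1 < q) (i : ℕ) :
    ∑ k ∈ Finset.Icc 1 i, q ^ k = q * (q ^ i - 1) / (q - 1) := by
  rw [← sub_one_mul_sum_Icc_pow hq, Nat.mul_div_cancel_left _ (by lia)]

section

variable {F : Type*} [NormedField F] [IsUltrametricDist F] {θ : F} {q : ℕ}

theorem norm_sub_pow_of_one_lt_norm (hθ : 1 < ‖θ‖) {m : ℕ} (hm : 1 < m) :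
    ‖θ - θ ^ m‖ = ‖θ‖ ^ m := by
  have h : ‖θ‖ < ‖θ ^ m‖ := by
    rw [norm_pow]
    exact lt_self_pow₀ hθ hm
  rw [sub_eq_add_neg,
    IsUltrametricDist.norm_add_eq_max_of_norm_ne_norm (by rw [norm_neg]; exact h.ne),
    norm_neg, max_eq_right h.le, norm_pow]

theorem norm_Lfac (hθ : 1 < ‖θ‖) (hq : 1 < q) (i : ℕ) :
    ‖Lfac θ q i‖ = ‖θ‖ ^ ∑ k ∈ Finset.Icc 1 i, q ^ k := by
  rw [Lfac, norm_prod, ← Finset.prod_pow_eq_pow_sum]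
  refine Finset.prod_congr rfl fun k hk => norm_sub_pow_of_one_lt_norm hθ ?_
  exact Nat.one_lt_pow (by have := (Finset.mem_Icc.1 hk).1; lia) hq

theorem norm_Lfac_pow_mul_rpow (hθ : 1 < ‖θ‖) (hq : 1 < q) (n i : ℕ) :
    ‖Lfac θ q i ^ n‖ * ‖θ‖ ^ (((n : ℝ) * q) / ((q : ℝ) - 1)) =
      (‖θ‖ ^ (((n : ℝ) * q) / ((q : ℝ) - 1))) ^ q ^ i := by
  have h0 : 0 < ‖θ‖ := by linarith
  have hq' : (q : ℝ) - 1 ≠ 0 := by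
    have : (1 : ℝ) < q := by exact_mod_cast hq
    linarith
  have hsum : ((q : ℝ) - 1) * (∑ k ∈ Finset.Icc 1 i, q ^ k : ℕ) = q * ((q : ℝ) ^ i - 1) := by
    have := congrArg (Nat.cast (R := ℝ)) (sub_one_mul_sum_Icc_pow hq i)
    rwa [Nat.cast_mul, Nat.cast_mul, Nat.cast_sub hq.le,
      Nat.cast_sub (Nat.one_le_pow _ _ (by lia)), Nat.cast_pow, Nat.cast_one] at this
  rw [norm_pow, norm_Lfac hθ hq, ← pow_mul, ← Real.rpow_natCast, ← Real.rpow_add h0,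
    ← Real.rpow_mul_natCast h0.le]
  congr 1
  rw [Nat.cast_mul, Nat.cast_pow]
  field_simp
  linear_combination (n : ℝ) * hsum

theorem norm_pow_div_Lfac_pow_le (hθ : 1 < ‖θ‖) (hq : 1 < q) {n : ℕ} {z : F} {r : ℝ} (hr : r ≤ 1)
    (hz : ‖z‖ / ‖θ‖ ^ (((n : ℝ) * q) / ((q : ℝ) - 1)) ≤ r) (i : ℕ) :
    ‖z ^ q ^ i / Lfac θ q i ^ n‖ ≤ ‖θ‖ ^ (((n : ℝ) * q) / ((q : ℝ) - 1)) * r ^ i := by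
  have hT := norm_Lfac_pow_mul_rpow hθ hq n i
  have hT0 : 0 < ‖θ‖ ^ (((n : ℝ) * q) / ((q : ℝ) - 1)) := Real.rpow_pos_of_pos (by linarith) _
  generalize ‖θ‖ ^ (((n : ℝ) * q) / ((q : ℝ) - 1)) = T at *
  have hr0 : 0 ≤ r := le_trans (by positivity) hz
  have hL : ‖Lfac θ q i ^ n‖ = T ^ q ^ i / T := by
    rw [← hT, mul_div_cancel_right₀ _ hT0.ne']
  calc ‖z ^ q ^ i / Lfac θ q i ^ n‖ = T * (‖z‖ / T) ^ q ^ i := by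
        rw [norm_div, norm_pow z, hL, div_pow]
        field_simp
    _ ≤ T * r ^ q ^ i := by gcongr
    _ ≤ T * r ^ i := by
        gcongr T * ?_
        exact pow_le_pow_of_le_one hr0 hr (Nat.lt_pow_self hq).le

end

theorem tendsto_sum_cofinite_atTop {ι : Type*} [Fintype ι] :
    Tendsto (fun f : ι → ℕ => ∑ j, f j) cofinite atTop := by
  classical
  refine tendsto_atTop.2 fun N => ?_
  refine (Set.finite_Iic fun _ : ι => N).subset fun f hf j => ?_
  have hlt : ∑ j, f j < N := not_le.1 hf
  exact (Finset.single_le_sum (fun _ _ => Nat.zero_le _) (Finset.mem_univ j)).trans hlt.le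

theorem summable_prod_of_norm_le_geometric {F ι : Type*} [NormedField F] [CompleteSpace F]
    [IsUltrametricDist F] [Fintype ι] {a : ι → ℕ → F} {C : ι → ℝ} {r : ℝ} (hr0 : 0 ≤ r)
    (hr : r < 1) (ha : ∀ j i, ‖a j i‖ ≤ C j * r ^ i) :
    Summable fun f : ι → ℕ => ∏ j, a j (f j) := by
  refine NonarchimedeanAddGroup.summable_of_tendsto_cofinite_zero ?_
  refine squeeze_zero_norm (a := fun f : ι → ℕ => (∏ j, C j) * r ^ ∑ j, f j) (fun f => ?_) ?_
  · rw [norm_prod, ← Finset.prod_pow_eq_pow_sum, ← Finset.prod_mul_distrib]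
    exact Finset.prod_le_prod (fun _ _ => norm_nonneg _) fun j _ => ha j (f j)
  · simpa using ((tendsto_pow_atTop_nhds_zero_of_lt_one hr0 hr).comp
      tendsto_sum_cofinite_atTop).const_mul (∏ j, C j)

/-- For positive `n_j` and `‖z_j‖ < ‖θ‖^{n_j q/(q-1)}`, each `L_i` is
nonzero with `‖L_i‖ = ‖θ‖^{q(q^i - 1)/(q - 1)}` (the natural-number exponent
`q + q^2 + ⋯ + q^i`), and the Carlitz multiple polylogarithm family
`z_1^{q^{i_1}} ⋯ z_d^{q^{i_d}} / (L_{i_1}^{n_1} ⋯ L_{i_d}^{n_d})` over strictly increasing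
tuples is summable. -/
theorem stmt_11 {p s q : ℕ} (hp : p.Prime) (hs : 0 < s) (hq : q = p ^ s)
    {F : Type*} [NormedField F] [CompleteSpace F] [IsUltrametricDist F] [CharP F p]
    (θ : F) (hθ : 1 < ‖θ‖) (d : ℕ) (hd : 1 ≤ d)
    (n : Fin d → ℕ) (hn : ∀ j, 1 ≤ n j) (z : Fin d → F)
    (hz : ∀ j, ‖z j‖ < ‖θ‖ ^ (((n j : ℝ) * q) / ((q : ℝ) - 1))) :
    (∀ i : ℕ, Lfac θ q i ≠ 0 ∧ ‖Lfac θ q i‖ = ‖θ‖ ^ (q * (q ^ i - 1) / (q - 1))) ∧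
    Summable (fun f : {f : Fin d → ℕ // StrictMono f} =>
      (∏ j, z j ^ q ^ (f.1 j)) / ∏ j, (Lfac θ q (f.1 j)) ^ (n j)) := by
  have hq1 : 1 < q := hq ▸ Nat.one_lt_pow hs.ne' hp.one_lt
  refine ⟨fun i => ?_, ?_⟩
  · have h := norm_Lfac hθ hq1 i
    refine ⟨norm_pos_iff.1 ?_, by rw [h, sum_Icc_pow hq1]⟩
    rw [h]
    exact pow_pos (by linarith) _
  · have hlt (j : Fin d) : ‖z j‖ / ‖θ‖ ^ (((n j : ℝ) * q) / ((q : ℝ) - 1)) < 1 :=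
      (div_lt_one (Real.rpow_pos_of_pos (by linarith) _)).2 (hz j)
    obtain ⟨r, ⟨hzr, hr0⟩, hr⟩ := (((eventually_all.2 fun j =>
      nhdsWithin_le_nhds (lt_mem_nhds (hlt j))).and (nhdsWithin_le_nhds
        (lt_mem_nhds zero_lt_one))).and (self_mem_nhdsWithin (s := Set.Iio (1 : ℝ)))).exists
    simp only [← Finset.prod_div_distrib]
    exact (summable_prod_of_norm_le_geometric (a := fun j i => z j ^ q ^ i / Lfac θ q i ^ n j)
      (le_of_lt hr0) hr fun j i => norm_pow_div_Lfac_pow_le hθ hq1 (le_of_lt hr)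
        (le_of_lt (hzr j)) i).subtype {f | StrictMono f}
end

section
/- Let d ≥ 1, n_1, …, n_d positive integers, and z_1, …, z_d ∈ F with ‖z_j‖ < ‖θ‖^{n_j·q/(q−1)} for all j. Then the family (z_1^{q^{i_1}}⋯z_d^{q^{i_d}} / (L_{i_1}^{n_1}⋯L_{i_d}^{n_d})) indexed by tuples of integers 0 ≤ i_1 ≤ ⋯ ≤ i_d is summable in F. (Convergence of the Carlitz multiple star polylogarithm Li⋆_{n_1,…,n_d}(z_1,…,z_d) on the polydisk.) -/
theorem summable_prod_pi_of_nonneg {d : ℕ} (g : Fin d → ℕ → ℝ) (hg : ∀ j i, 0 ≤ g j i)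
    (hs : ∀ j, Summable (g j)) : Summable (fun f : Fin d → ℕ => ∏ j, g j (f j)) := by
  induction d with
  | zero => exact Summable.of_finite
  | succ d ih =>
    have h := (hs 0).mul_of_nonneg (ih (fun j => g j.succ) (fun j => hg j.succ) fun j => hs j.succ)
      (hg 0) (fun f => Finset.prod_nonneg fun j _ => hg j.succ (f j))
    rw [← (Fin.consEquiv fun _ => ℕ).summable_iff]
    refine h.congr fun x => ?_
    simp [Fin.prod_univ_succ, Fin.consEquiv]

theorem norm_sub_pow_of_one_lt {F : Type*} [NormedField F] [IsUltrametricDist F] {θ : F}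
    (hθ : 1 < ‖θ‖) {m : ℕ} (hm : 1 < m) : ‖θ - θ ^ m‖ = ‖θ‖ ^ m := by
  have h : ‖θ‖ < ‖θ ^ m‖ := by
    rw [norm_pow]
    exact lt_self_pow₀ hθ hm
  rw [sub_eq_add_neg, IsUltrametricDist.norm_add_eq_max_of_norm_ne_norm (by rw [norm_neg]; exact h.ne),
    norm_neg, max_eq_right h.le, norm_pow]

theorem norm_Lfac_s12 {F : Type*} [NormedField F] [IsUltrametricDist F] {θ : F}
    (hθ : 1 < ‖θ‖) {q : ℕ} (hq : 1 < q) (i : ℕ) :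
    ‖Lfac θ q i‖ = ‖θ‖ ^ (((q : ℝ) ^ (i + 1) - q) / ((q : ℝ) - 1)) := by
  have hq' : (q : ℝ) - 1 ≠ 0 := sub_ne_zero.2 (by exact_mod_cast hq.ne')
  have h0 : 0 < ‖θ‖ := one_pos.trans hθ
  induction i with
  | zero => simp [Lfac]
  | succ i ih =>
    have h : Lfac θ q (i + 1) = Lfac θ q i * (θ - θ ^ q ^ (i + 1)) :=
      Finset.prod_Icc_succ_top (by omega) _
    rw [h, norm_mul, ih, norm_sub_pow_of_one_lt hθ (Nat.one_lt_pow (by omega) hq),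
      ← Real.rpow_natCast ‖θ‖, ← Real.rpow_add h0]
    congr 1
    push_cast
    field_simp
    ring

theorem norm_pow_div_Lfac_pow {F : Type*} [NormedField F] [IsUltrametricDist F] {θ : F}
    (hθ : 1 < ‖θ‖) {q : ℕ} (hq : 1 < q) (n : ℕ) (z : F) (i : ℕ) :
    ‖z ^ q ^ i / Lfac θ q i ^ n‖ = ‖θ‖ ^ ((n : ℝ) * q / ((q : ℝ) - 1)) *
      (‖z‖ / ‖θ‖ ^ ((n : ℝ) * q / ((q : ℝ) - 1))) ^ q ^ i := by
  have h0 : 0 < ‖θ‖ := one_pos.trans hθ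
  have hL : ‖Lfac θ q i‖ ^ n * ‖θ‖ ^ ((n : ℝ) * q / ((q : ℝ) - 1)) =
      (‖θ‖ ^ ((n : ℝ) * q / ((q : ℝ) - 1))) ^ q ^ i := by
    rw [norm_Lfac_s12 hθ hq, ← Real.rpow_mul_natCast h0.le, ← Real.rpow_mul_natCast h0.le,
      ← Real.rpow_add h0]
    congr 1
    push_cast
    ring
  have hc : 0 < ‖θ‖ ^ ((n : ℝ) * q / ((q : ℝ) - 1)) := Real.rpow_pos_of_pos h0 _
  have hl : 0 < ‖Lfac θ q i‖ := by
    rw [norm_Lfac_s12 hθ hq]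
    exact Real.rpow_pos_of_pos h0 _
  rw [norm_div, norm_pow, norm_pow, div_pow, ← hL]
  field_simp

theorem summable_norm_pow_div_Lfac_pow {F : Type*} [NormedField F] [IsUltrametricDist F] {θ : F}
    (hθ : 1 < ‖θ‖) {q : ℕ} (hq : 1 < q) {n : ℕ} {z : F}
    (hz : ‖z‖ < ‖θ‖ ^ ((n : ℝ) * q / ((q : ℝ) - 1))) :
    Summable fun i => ‖z ^ q ^ i / Lfac θ q i ^ n‖ := by
  have hc : 0 < ‖θ‖ ^ ((n : ℝ) * q / ((q : ℝ) - 1)) := (norm_nonneg z).trans_lt hz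
  have hr0 : 0 ≤ ‖z‖ / ‖θ‖ ^ ((n : ℝ) * q / ((q : ℝ) - 1)) := by positivity
  have hr1 : ‖z‖ / ‖θ‖ ^ ((n : ℝ) * q / ((q : ℝ) - 1)) < 1 := (div_lt_one hc).2 hz
  simp_rw [norm_pow_div_Lfac_pow hθ hq]
  refine Summable.mul_left _ (Summable.of_nonneg_of_le (fun i => pow_nonneg hr0 _) (fun i => ?_)
    (summable_geometric_of_lt_one hr0 hr1))
  exact pow_le_pow_of_le_one hr0 hr1.le (Nat.lt_pow_self hq).le

/-- For positive `n_j` and `‖z_j‖ < ‖θ‖^{n_j q/(q-1)}`, the Carlitz multiple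
star polylogarithm family `z_1^{q^{i_1}} ⋯ z_d^{q^{i_d}} / (L_{i_1}^{n_1} ⋯ L_{i_d}^{n_d})`
over weakly increasing tuples `0 ≤ i_1 ≤ ⋯ ≤ i_d` is summable. -/
theorem stmt_12 {p s q : ℕ} (hp : p.Prime) (hs : 0 < s) (hq : q = p ^ s)
    {F : Type*} [NormedField F] [CompleteSpace F] [IsUltrametricDist F] [CharP F p]
    (θ : F) (hθ : 1 < ‖θ‖) (d : ℕ) (hd : 1 ≤ d)
    (n : Fin d → ℕ) (hn : ∀ j, 1 ≤ n j) (z : Fin d → F)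
    (hz : ∀ j, ‖z j‖ < ‖θ‖ ^ (((n j : ℝ) * q) / ((q : ℝ) - 1))) :
    Summable (fun f : {f : Fin d → ℕ // Monotone f} =>
      (∏ j, z j ^ q ^ (f.1 j)) / ∏ j, (Lfac θ q (f.1 j)) ^ (n j)) := by
  have hq1 : 1 < q := hq ▸ Nat.one_lt_pow hs.ne' hp.one_lt
  have h := summable_prod_pi_of_nonneg (fun j i => ‖z j ^ q ^ i / Lfac θ q i ^ n j‖)
    (fun _ _ => norm_nonneg _) fun j => summable_norm_pow_div_Lfac_pow hθ hq1 (hz j)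
  refine Summable.of_norm ((h.comp_injective Subtype.val_injective).congr fun f => ?_)
  simp only [Function.comp_apply, ← Finset.prod_div_distrib, norm_prod]
end

section
/- For every x ∈ F the family (1 − x·θ^{−q^i})_{i≥1} is multipliable, so Ω(x) = η^{−q}·∏_{i=1}^∞ (1 − x·θ^{−q^i}) is a well-defined function on F. Moreover Ω(θ^{q^k}) = 0 for every integer k ≥ 1, and Ω(x) ≠ 0 for every x not of the form θ^{q^k} with k ≥ 1; in particular Ω(θ) ≠ 0. -/
/-- The Anderson–Thakur function `Ω(x) = η^{-q} ∏_{i≥1} (1 - x/θ^{q^i})`,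
where `η` is a fixed `(q-1)`-th root of `-θ`. -/
noncomputable def OmegaATF (q : ℕ) {F : Type*} [NormedField F] (θ η : F) (x : F) : F :=
  η⁻¹ ^ q * ∏' i : ℕ, (1 - x * (θ ^ q ^ (i + 1))⁻¹)

theorem summable_norm_mul_inv_pow_pow {F : Type*} [NormedField F] {q : ℕ} (hq : 2 ≤ q) {θ : F}
    (hθ : 1 < ‖θ‖) (x : F) : Summable fun i : ℕ => ‖x * (θ ^ q ^ (i + 1))⁻¹‖ := by
  have hgeom : Summable fun i : ℕ => ‖x‖ * ‖θ‖⁻¹ ^ i :=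
    (summable_geometric_of_lt_one (by positivity) (inv_lt_one_of_one_lt₀ hθ)).mul_left _
  refine hgeom.of_nonneg_of_le (fun i => norm_nonneg _) fun i => ?_
  rw [norm_mul, norm_inv, norm_pow, inv_pow]
  have hi : i ≤ q ^ (i + 1) := (Nat.lt_succ_self i).le.trans (Nat.lt_pow_self (by lia)).le
  gcongr
  exact hθ.le

theorem one_sub_mul_inv_eq_zero_iff {F : Type*} [Field F] {a x : F} (ha : a ≠ 0) :
    1 - x * a⁻¹ = 0 ↔ x = a := by
  rw [sub_eq_zero, eq_comm, mul_inv_eq_one₀ ha]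

/-- The infinite product defining `Ω` converges (is multipliable) for every
`x ∈ F`; `Ω` vanishes exactly at the points `θ^{q^k}`, `k ≥ 1`; in particular `Ω(θ) ≠ 0`. -/
theorem stmt_13 {p s q : ℕ} (hp : p.Prime) (hs : 0 < s) (hq : q = p ^ s)
    {F : Type*} [NormedField F] [CompleteSpace F] [IsUltrametricDist F] [CharP F p]
    (θ η : F) (hθ : 1 < ‖θ‖) (hη : η ^ (q - 1) = -θ) :
    (∀ x : F, Multipliable (fun i : ℕ => 1 - x * (θ ^ q ^ (i + 1))⁻¹)) ∧
    (∀ k : ℕ, 1 ≤ k → OmegaATF q θ η (θ ^ q ^ k) = 0) ∧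
    (∀ x : F, (∀ k : ℕ, 1 ≤ k → x ≠ θ ^ q ^ k) → OmegaATF q θ η x ≠ 0) ∧
    OmegaATF q θ η θ ≠ 0 := by
  have hq2 : 2 ≤ q := hq ▸ hp.two_le.trans (Nat.le_self_pow hs.ne' p)
  have hθ0 : θ ≠ 0 := norm_pos_iff.mp (one_pos.trans hθ)
  have hη0 : η ≠ 0 := by
    rintro rfl
    rw [zero_pow (by lia)] at hη
    exact hθ0 (neg_eq_zero.mp hη.symm)
  have hsum (x : F) : Summable fun i : ℕ => ‖-(x * (θ ^ q ^ (i + 1))⁻¹)‖ := by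
    simpa only [norm_neg] using summable_norm_mul_inv_pow_pow hq2 hθ x
  have hne (x : F) (hx : ∀ k : ℕ, 1 ≤ k → x ≠ θ ^ q ^ k) : OmegaATF q θ η x ≠ 0 := by
    refine mul_ne_zero (pow_ne_zero _ (inv_ne_zero hη0)) ?_
    simp only [sub_eq_add_neg]
    refine tprod_one_add_ne_zero_of_summable (fun i => ?_) (hsum x)
    rw [← sub_eq_add_neg, Ne, one_sub_mul_inv_eq_zero_iff (pow_ne_zero _ hθ0)]
    exact hx (i + 1) (by lia)
  refine ⟨fun x => ?_, fun k hk => ?_, hne, hne θ fun k hk h => ?_⟩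
  · simpa only [sub_eq_add_neg] using multipliable_one_add_of_summable (hsum x)
  · refine mul_eq_zero_of_right _ (tprod_of_exists_eq_zero ⟨k - 1, ?_⟩)
    rw [Nat.sub_add_cancel hk, one_sub_mul_inv_eq_zero_iff (pow_ne_zero _ hθ0)]
  · have hlt : ‖θ‖ ^ 1 < ‖θ‖ ^ q ^ k :=
      pow_lt_pow_right₀ hθ (Nat.one_lt_pow (by lia) (by lia))
    rw [pow_one, ← norm_pow, ← h] at hlt
    exact lt_irrefl _ hlt
end

section
/- For every x ∈ F one has Ω(x^q) = (x − θ)^q · Ω(x)^q. (This is the function-level form of the difference equation Ω^{(−1)}(t) = (t − θ)·Ω(t) satisfied by the Anderson–Thakur function.) -/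
/-- The factors of the Anderson–Thakur product are multipliable, for every argument. -/
theorem multipliable_one_sub_mul_inv_pow {q : ℕ} (hq : 1 < q)
    {F : Type*} [NormedField F] [CompleteSpace F] (θ : F) (hθ : 1 < ‖θ‖) (x : F) :
    Multipliable fun i : ℕ => 1 - x * (θ ^ q ^ (i + 1))⁻¹ := by
  have hinv : ‖θ‖⁻¹ < 1 := inv_lt_one_of_one_lt₀ hθ
  have hgeom : Summable fun i : ℕ => ‖x‖ * ‖θ‖⁻¹ ^ i :=
    (summable_geometric_of_lt_one (by positivity) hinv).mul_left _
  have hsum : Summable fun i : ℕ => ‖-(x * (θ ^ q ^ (i + 1))⁻¹)‖ := by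
    refine hgeom.of_nonneg_of_le (fun _ => norm_nonneg _) fun i => ?_
    rw [norm_neg, norm_mul, norm_inv, norm_pow, ← inv_pow]
    have hi : i ≤ q ^ (i + 1) := (Nat.le_succ i).trans (Nat.lt_pow_self hq).le
    exact mul_le_mul_of_nonneg_left
      (pow_le_pow_of_le_one (by positivity) hinv.le hi) (norm_nonneg x)
  simpa only [sub_eq_add_neg] using multipliable_one_add_of_summable hsum

/-- The function-level difference equation `Ω^{(-1)}(t) = (t - θ)Ω(t)`:
for every `x ∈ F`, `Ω(x^q) = (x - θ)^q · Ω(x)^q`. -/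
theorem stmt_14 {p s q : ℕ} (hp : p.Prime) (hs : 0 < s) (hq : q = p ^ s)
    {F : Type*} [NormedField F] [CompleteSpace F] [IsUltrametricDist F] [CharP F p]
    (θ η : F) (hθ : 1 < ‖θ‖) (hη : η ^ (q - 1) = -θ) :
    ∀ x : F, OmegaATF q θ η (x ^ q) = (x - θ) ^ q * (OmegaATF q θ η x) ^ q := by
  intro x
  have : Fact p.Prime := ⟨hp⟩
  have hq1 : 1 < q := hq ▸ Nat.one_lt_pow hs.ne' hp.one_lt
  have hθ0 : θ ≠ 0 := norm_pos_iff.mp (one_pos.trans hθ)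
  have hη0 : η ≠ 0 := by
    rintro rfl
    rw [zero_pow (Nat.sub_ne_zero_of_lt hq1)] at hη
    exact hθ0 (neg_eq_zero.mp hη.symm)
  have hfrob : ∀ a b : F, (a - b) ^ q = a ^ q - b ^ q := fun a b => by
    rw [hq]; exact sub_pow_char_pow a b s
  have hterm : ∀ i : ℕ, (1 - x * (θ ^ q ^ (i + 1))⁻¹) ^ q =
      1 - x ^ q * (θ ^ q ^ (i + 1 + 1))⁻¹ := fun i => by
    rw [hfrob, one_pow, mul_pow, inv_pow, ← pow_mul, ← pow_succ]
  have hprod : (∏' i : ℕ, (1 - x * (θ ^ q ^ (i + 1))⁻¹)) ^ q =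
      ∏' i : ℕ, (1 - x ^ q * (θ ^ q ^ (i + 1 + 1))⁻¹) := by
    have h := (multipliable_one_sub_mul_inv_pow hq1 θ hθ x).map_tprod
      (powMonoidHom q : F →* F) (continuous_pow q)
    simpa only [powMonoidHom_apply, hterm] using h
  have hshift : Multipliable fun i : ℕ => 1 - x ^ q * (θ ^ q ^ (i + 1 + 1))⁻¹ := by
    have h := (multipliable_one_sub_mul_inv_pow hq1 θ hθ x).map
      (powMonoidHom q : F →* F) (continuous_pow q)
    simpa only [Function.comp_def, powMonoidHom_apply, hterm] using h
  have hconst : (x - θ) * η⁻¹ ^ q = η⁻¹ * (1 - x * θ⁻¹) := by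
    have hmul : (x - θ) = -θ * (1 - x * θ⁻¹) := by field_simp; ring
    have hpow : -θ * η⁻¹ ^ q = η⁻¹ := by
      rw [← hη, ← pow_sub_one_mul (by omega : q ≠ 0) η⁻¹, ← mul_assoc, ← mul_pow,
        mul_inv_cancel₀ hη0, one_pow, one_mul]
    rw [hmul, mul_right_comm, hpow]
  have hfirst : (1 - x * θ⁻¹) ^ q = 1 - x ^ q * (θ ^ q ^ (0 + 1))⁻¹ := by
    rw [hfrob, one_pow, mul_pow, inv_pow, zero_add, pow_one]
  unfold OmegaATF
  rw [mul_pow, ← mul_assoc, ← mul_pow, hconst, mul_pow, hfirst, hprod,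
    tprod_eq_zero_mul' (f := fun i : ℕ => 1 - x ^ q * (θ ^ q ^ (i + 1))⁻¹) hshift,
    mul_assoc]
end

section
/- Assume F is algebraically closed. Let d ≥ 1 and let z_1, …, z_d ∈ F with ‖z_j‖ < 1 for all j; for 1 ≤ k ≤ d write S_k = S_k(z_{d−k+1},…,z_d), the sums of the convergent series defined below, and S_0 = 1. Then the solutions (y_1, …, y_d) ∈ F^d of the system of Artin–Schreier equations y_k − y_k^q = z_{d−k+1} · y_{k−1}^q (for 1 ≤ k ≤ d, with y_0 = 1) that satisfy ‖y_k‖ < 1 for all k are exactly (S_1, …, S_d); in particular such a solution with all coordinates in the open unit ball exists and is unique. (Uniqueness of the principal branch of 𝔏i_{{0}^d} among small solutions of the defining difference system.) -/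
theorem norm_prod_pow_le_factor {q : ℕ} {F : Type*} [NormedField F] {n : ℕ} {z : Fin n → F}
    (hz : ∀ j, ‖z j‖ < 1) (f : Fin n → ℕ) (i : Fin n) :
    ‖∏ j, z j ^ q ^ f j‖ ≤ ‖z i‖ ^ q ^ f i := by
  rw [norm_prod, ← Finset.mul_prod_erase _ _ (Finset.mem_univ i), norm_pow]
  refine mul_le_of_le_one_right (by positivity) (Finset.prod_le_one (fun _ _ => norm_nonneg _) ?_)
  intro j _
  rw [norm_pow]
  exact pow_le_one₀ (norm_nonneg _) (hz j).le

theorem summable_prod_pow_strictMono {q : ℕ} (hq : 1 < q) {F : Type*} [NormedField F]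
    [CompleteSpace F] [IsUltrametricDist F] {n : ℕ} {z : Fin n → F} (hz : ∀ j, ‖z j‖ < 1) :
    Summable fun f : {f : Fin n → ℕ // StrictMono f} => ∏ j, z j ^ q ^ f.1 j := by
  apply NonarchimedeanAddGroup.summable_of_tendsto_cofinite_zero
  rw [Metric.tendsto_nhds]
  intro ε hε
  have hev : ∀ᶠ m : ℕ in Filter.atTop, ∀ j, ‖z j‖ ^ q ^ m < ε := by
    rw [Filter.eventually_all]
    intro j
    exact ((tendsto_pow_atTop_nhds_zero_of_lt_one (norm_nonneg _) (hz j)).comp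
      (tendsto_pow_atTop_atTop_of_one_lt hq)).eventually (gt_mem_nhds hε)
  obtain ⟨N, hN⟩ := Filter.eventually_atTop.mp hev
  have hfin : {f : {f : Fin n → ℕ // StrictMono f} | ∀ j, f.1 j < N}.Finite := by
    refine Set.Finite.of_finite_image (f := Subtype.val)
      ((Set.Finite.pi' fun _ : Fin n => Set.finite_lt_nat N).subset ?_)
      Subtype.val_injective.injOn
    rintro _ ⟨f, hf, rfl⟩
    exact hf
  rw [Filter.eventually_cofinite]
  refine hfin.subset fun f hf j => ?_
  by_contra! hj
  refine hf ?_
  rw [dist_zero_right]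
  exact (norm_prod_pow_le_factor hz f.1 j).trans_lt (hN _ hj j)

theorem norm_Scmpl_succ_lt_one {q : ℕ} (hq : 1 < q) {F : Type*} [NormedField F]
    [IsUltrametricDist F] {n : ℕ} {z : Fin (n + 1) → F} (hz : ∀ j, ‖z j‖ < 1) :
    ‖Scmpl q (n + 1) z‖ < 1 := by
  refine lt_of_le_of_lt ?_ (hz 0)
  refine IsUltrametricDist.norm_tsum_le_of_forall_le_of_nonneg (norm_nonneg _) fun f => ?_
  refine (norm_prod_pow_le_factor hz f.1 0).trans (pow_le_of_le_one (norm_nonneg _) (hz 0).le ?_)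
  exact (pow_pos (by omega) _).ne'

/-- A strictly increasing sequence either avoids `0`, and is then a shift, or starts with `0`
followed by a shift. -/
def strictMonoFinSuccEquiv (n : ℕ) :
    {f : Fin (n + 1) → ℕ // StrictMono f} ⊕ {f : Fin n → ℕ // StrictMono f} ≃
      {f : Fin (n + 1) → ℕ // StrictMono f} where
  toFun := Sum.elim (fun f => ⟨fun j => f.1 j + 1, fun _ _ h => Nat.succ_lt_succ (f.2 h)⟩)
    (fun g => ⟨Fin.cons 0 fun j => g.1 j + 1, by
      intro i j h
      induction j using Fin.cases with
      | zero => exact absurd h (Fin.not_lt_zero i)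
      | succ j =>
        induction i using Fin.cases with
        | zero => simp
        | succ i => simpa using g.2 (Fin.succ_lt_succ_iff.mp h)⟩)
  invFun f := if h : f.1 0 = 0 then
      Sum.inr ⟨fun j => f.1 j.succ - 1, fun i j hij => by
        have h0 := f.2 (Fin.succ_pos i)
        have h1 := f.2 (Fin.succ_lt_succ_iff.mpr hij)
        dsimp only
        omega⟩
    else Sum.inl ⟨fun j => f.1 j - 1, fun i j hij => by
        have h0 := f.2.monotone (Fin.zero_le i)
        have h1 := f.2 hij
        dsimp only
        omega⟩
  left_inv := by
    rintro (f | g) <;> simp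
  right_inv := by
    intro f
    by_cases h : f.1 0 = 0
    · simp only [h, dite_true, Sum.elim_inr]
      ext j
      induction j using Fin.cases with
      | zero => simp [h]
      | succ j =>
        have h0 := f.2 (Fin.succ_pos j)
        simp only [Fin.cons_succ]
        omega
    · simp only [h, dite_false, Sum.elim_inl]
      ext j
      have h0 := f.2.monotone (Fin.zero_le j)
      dsimp only
      omega

theorem tsum_pow_char_pow {p : ℕ} (hp : p.Prime) (s : ℕ) {F : Type*} [NormedField F] [CharP F p]
    {ι : Type*} {a : ι → F} (ha : Summable a) :
    ∑' i, a i ^ p ^ s = (∑' i, a i) ^ p ^ s := by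
  have := Fact.mk hp
  have hc : Continuous (iterateFrobenius F p s) := continuous_pow (p ^ s)
  exact (ha.hasSum.map (iterateFrobenius F p s) hc).tsum_eq

theorem Scmpl_succ_sub_pow {p s : ℕ} (hp : p.Prime) (hs : 0 < s) {F : Type*} [NormedField F]
    [CompleteSpace F] [IsUltrametricDist F] [CharP F p] {n : ℕ} {z : Fin (n + 1) → F}
    (hz : ∀ j, ‖z j‖ < 1) :
    Scmpl (p ^ s) (n + 1) z - Scmpl (p ^ s) (n + 1) z ^ p ^ s =
      z 0 * Scmpl (p ^ s) n (fun j => z j.succ) ^ p ^ s := by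
  have hq : 1 < p ^ s := Nat.one_lt_pow hs.ne' hp.one_lt
  have hsum := summable_prod_pow_strictMono hq hz
  have hsum' := summable_prod_pow_strictMono hq (z := fun j : Fin n => z j.succ) fun j => hz _
  have hsum_equiv := (strictMonoFinSuccEquiv n).summable_iff.mpr hsum
  have key : Scmpl (p ^ s) (n + 1) z = Scmpl (p ^ s) (n + 1) z ^ p ^ s +
      z 0 * Scmpl (p ^ s) n (fun j => z j.succ) ^ p ^ s := by
    conv_lhs => rw [Scmpl, ← (strictMonoFinSuccEquiv n).tsum_eq]
    refine (Summable.tsum_sum (hsum_equiv.comp_injective Sum.inl_injective)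
      (hsum_equiv.comp_injective Sum.inr_injective)).trans ?_
    congr 1
    · rw [Scmpl, ← tsum_pow_char_pow hp s hsum]
      simp [strictMonoFinSuccEquiv, pow_succ, pow_mul, Finset.prod_pow]
    · rw [Scmpl, ← tsum_pow_char_pow hp s hsum', ← tsum_mul_left]
      simp [strictMonoFinSuccEquiv, Fin.prod_univ_succ, pow_succ, pow_mul, Finset.prod_pow]
  exact sub_eq_of_eq_add' key

theorem Scmpl_zero {q : ℕ} {F : Type*} [NormedField F] (z : Fin 0 → F) : Scmpl q 0 z = 1 := by
  have : Unique {f : Fin 0 → ℕ // StrictMono f} :=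
    { default := ⟨Fin.elim0, fun i => i.elim0⟩
      uniq := fun _ => Subtype.ext (Subsingleton.elim _ _) }
  rw [Scmpl, tsum_fintype]
  simp

theorem eq_of_sub_pow_eq_of_norm_lt_one {p s : ℕ} (hp : p.Prime) (hs : 0 < s) {F : Type*}
    [NormedField F] [IsUltrametricDist F] [CharP F p] {x y : F} (hx : ‖x‖ < 1) (hy : ‖y‖ < 1)
    (h : x - x ^ p ^ s = y - y ^ p ^ s) : x = y := by
  have := Fact.mk hp
  have hq : 1 < p ^ s := Nat.one_lt_pow hs.ne' hp.one_lt
  have hδ : (x - y) ^ p ^ s = x - y := by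
    rw [sub_pow_char_pow]
    linear_combination -h
  have hlt : ‖x - y‖ < 1 := by
    rw [sub_eq_add_neg]
    exact (IsUltrametricDist.norm_add_le_max x (-y)).trans_lt (max_lt hx (by rwa [norm_neg]))
  by_contra hne
  have hpos : 0 < ‖x - y‖ := norm_pos_iff.mpr (sub_ne_zero.mpr hne)
  have hpow : ‖x - y‖ ^ p ^ s < ‖x - y‖ := pow_lt_self_of_lt_one₀ hpos hlt hq
  rw [← norm_pow, hδ] at hpow
  exact lt_irrefl _ hpow

/-- For `‖z_j‖ < 1`, the solutions `(y_1,…,y_d)` of the Artin–Schreier system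
`y_k − y_k^q = z_{d−k+1} · y_{k−1}^q` (`1 ≤ k ≤ d`, `y_0 = 1`) with all `‖y_k‖ < 1` are
exactly `y_k = S_k(z_{d−k+1},…,z_d)`; in particular such a small solution exists and is
unique (uniqueness of the principal branch of `𝔏i_{{0}^d}`).  Here `k : Fin d` encodes the
index `k+1`, so `y ⟨k⟩ = y_{k+1}` and `z ⟨d−1−k⟩ = z_{d−(k+1)+1}`. -/
theorem stmt_19 {p s q : ℕ} (hp : p.Prime) (hs : 0 < s) (hq : q = p ^ s)
    {F : Type*} [NormedField F] [CompleteSpace F] [IsUltrametricDist F] [CharP F p]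
    [IsAlgClosed F]
    (d : ℕ) (hd : 1 ≤ d) (z : Fin d → F) (hz : ∀ j, ‖z j‖ < 1) :
    (∀ y : Fin d → F,
      ((∀ k : Fin d, y k - (y k) ^ q =
          z ⟨d - 1 - k.1, by have := k.isLt; omega⟩ *
            (if h : k.1 = 0 then 1 else y ⟨k.1 - 1, by have := k.isLt; omega⟩) ^ q) ∧
        (∀ k : Fin d, ‖y k‖ < 1)) ↔
      (∀ k : Fin d, y k = Scmpl q (k.1 + 1)
          (fun j => z ⟨d - (k.1 + 1) + j.1, by have := k.isLt; have := j.isLt; omega⟩))) ∧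
    ∃! y : Fin d → F,
      (∀ k : Fin d, y k - (y k) ^ q =
          z ⟨d - 1 - k.1, by have := k.isLt; omega⟩ *
            (if h : k.1 = 0 then 1 else y ⟨k.1 - 1, by have := k.isLt; omega⟩) ^ q) ∧
      (∀ k : Fin d, ‖y k‖ < 1) := by
  subst hq
  have hq : 1 < p ^ s := Nat.one_lt_pow hs.ne' hp.one_lt
  let S : Fin d → F := fun k => Scmpl (p ^ s) (k.1 + 1)
    (fun j => z ⟨d - (k.1 + 1) + j.1, by have := k.isLt; have := j.isLt; omega⟩)
  have hS_norm : ∀ k, ‖S k‖ < 1 := fun k => norm_Scmpl_succ_lt_one hq fun j => hz _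
  have hS_eq : ∀ k : Fin d, S k - (S k) ^ p ^ s =
      z ⟨d - 1 - k.1, by have := k.isLt; omega⟩ *
        (if h : k.1 = 0 then 1 else S ⟨k.1 - 1, by have := k.isLt; omega⟩) ^ p ^ s := by
    rintro ⟨k, hk⟩
    refine (Scmpl_succ_sub_pow hp hs fun j => hz _).trans ?_
    congr 1
    · congr 1
      ext
      simp
      omega
    · congr 1
      cases k with
      | zero => simp [Scmpl_zero]
      | succ m =>
        simp only [Nat.add_eq_zero_iff, one_ne_zero, and_false, dite_false, S,
          Nat.add_sub_cancel, Fin.val_succ]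
        congr 1
        funext j
        congr 2
        omega
  have huniq : ∀ y : Fin d → F,
      ((∀ k : Fin d, y k - (y k) ^ p ^ s =
          z ⟨d - 1 - k.1, by have := k.isLt; omega⟩ *
            (if h : k.1 = 0 then 1 else y ⟨k.1 - 1, by have := k.isLt; omega⟩) ^ p ^ s) ∧
        (∀ k : Fin d, ‖y k‖ < 1)) → ∀ k, y k = S k := by
    rintro y ⟨hy, hy_norm⟩ ⟨k, hk⟩
    induction k with
    | zero =>
      refine eq_of_sub_pow_eq_of_norm_lt_one hp hs (hy_norm _) (hS_norm _) ?_
      rw [hy, hS_eq]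
      simp
    | succ m ih =>
      refine eq_of_sub_pow_eq_of_norm_lt_one hp hs (hy_norm _) (hS_norm _) ?_
      rw [hy, hS_eq]
      simp [ih (by omega)]
  refine ⟨fun y => ⟨huniq y, fun h => ?_⟩, S, ⟨hS_eq, hS_norm⟩, fun y hy => funext (huniq y hy)⟩
  obtain rfl : y = S := funext h
  exact ⟨hS_eq, hS_norm⟩
end
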